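/- arXiv:2209.05215 — 2 statements merged into one kernel-verified Lean document; each statement's English description precedes it below -/
import Mathlib

section
/- Let K be a field of characteristic 2 and let u₁ ∈ SL(3,K) be the matrix with rows (1,1,0), (0,1,0), (0,0,1). Then there is no x ∈ SL(3,K) with x·τ(x)⁻¹ = u₁; equivalently, in the semidirect product SL(3,K)⋊⟨τ⟩, the element u₁τ does not lie in the SL(3,K)-conjugacy orbit of τ. -/
open Matrix

/-- The antidiagonal matrix `J` whose `(i,j)` entry (0-based) is `1` if `i + j + 1 = n`
and `0` otherwise. -/
def antidiagJ (n : ℕ) (K : Type*) [Field K] : Matrix (Fin n) (Fin n) K :=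
  Matrix.of fun i j => if (i : ℕ) + (j : ℕ) + 1 = n then 1 else 0

/-- The map `τ(X) = J ⬝ (Xᵀ)⁻¹ ⬝ J` on matrices. -/
noncomputable def tauMat (n : ℕ) (K : Type*) [Field K]
    (X : Matrix (Fin n) (Fin n) K) : Matrix (Fin n) (Fin n) K :=
  antidiagJ n K * (Xᵀ)⁻¹ * antidiagJ n K

theorem antidiagJ_apply (n : ℕ) (K : Type*) [Field K] (i j : Fin n) :
    antidiagJ n K i j = if i.rev = j then 1 else 0 := by
  have h : (i : ℕ) + j + 1 = n ↔ i.rev = j := by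
    rw [Fin.ext_iff, Fin.val_rev]
    omega
  simp [antidiagJ, h]

theorem antidiagJ_transpose (n : ℕ) (K : Type*) [Field K] :
    (antidiagJ n K)ᵀ = antidiagJ n K := by
  ext i j
  simp [antidiagJ, add_comm]

theorem antidiagJ_mul_self (n : ℕ) (K : Type*) [Field K] :
    antidiagJ n K * antidiagJ n K = 1 := by
  ext i j
  simp only [mul_apply, antidiagJ_apply, one_apply, ite_mul, one_mul, zero_mul, Finset.sum_ite_eq,
    Finset.mem_univ, if_true, Fin.rev_rev]

theorem tauMat_inv (n : ℕ) (K : Type*) [Field K] (X : Matrix (Fin n) (Fin n) K)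
    (hX : IsUnit X.det) : (tauMat n K X)⁻¹ = antidiagJ n K * Xᵀ * antidiagJ n K := by
  rw [tauMat, Matrix.mul_inv_rev, Matrix.mul_inv_rev, nonsing_inv_nonsing_inv _ (by rwa [det_transpose]),
    inv_eq_right_inv (antidiagJ_mul_self n K), mul_assoc]

/-- If `y = x * τ(x)⁻¹` then `y * J = x * J * xᵀ` is symmetric. -/
theorem isSymm_mul_tauMat_inv_mul_antidiagJ (n : ℕ) (K : Type*) [Field K]
    (X : Matrix (Fin n) (Fin n) K) (hX : IsUnit X.det) :
    (X * (tauMat n K X)⁻¹ * antidiagJ n K).IsSymm := by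
  have h : X * (tauMat n K X)⁻¹ * antidiagJ n K = X * antidiagJ n K * Xᵀ := by
    rw [tauMat_inv n K X hX]
    simp only [mul_assoc, antidiagJ_mul_self, mul_one]
  rw [h, IsSymm]
  simp only [transpose_mul, transpose_transpose, antidiagJ_transpose, mul_assoc]

/-- In characteristic `2`, there is no `x ∈ SL(3, K)` with `x · τ(x)⁻¹ = u₁`, where
`u₁` is the unitriangular matrix with rows `(1,1,0), (0,1,0), (0,0,1)`; that is, `u₁τ`
is not in the `SL(3, K)`-conjugacy orbit of `τ`. -/
theorem u1tau_not_in_orbit_of_tau (K : Type*) [Field K] [CharP K 2] :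
    ¬ ∃ x : Matrix.SpecialLinearGroup (Fin 3) K,
      (x : Matrix (Fin 3) (Fin 3) K) * (tauMat 3 K (x : Matrix (Fin 3) (Fin 3) K))⁻¹
        = !![1, 1, 0; 0, 1, 0; 0, 0, 1] := by
  rintro ⟨x, hx⟩
  have h := isSymm_mul_tauMat_inv_mul_antidiagJ 3 K (x : Matrix (Fin 3) (Fin 3) K) (by simp)
  rw [hx] at h
  simpa [mul_apply, Fin.sum_univ_three, antidiagJ] using h.apply 0 1
end

section
/- Let K be an algebraically closed field of characteristic 2, let a₁, a₂ ∈ K, and let ā ∈ SL(3,K) be the upper unitriangular matrix with (1,2)-entry a₁, (1,3)-entry a₂, and (2,3)-entry a₁ (equal superdiagonal entries). Then there exists an upper unitriangular matrix b ∈ SL(3,K) such that b·ā·τ(b)⁻¹ = Id; equivalently, āτ is conjugate to τ in SL(3,K)⋊⟨τ⟩ by an element of the upper unitriangular subgroup. -/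
open Matrix

theorem inv_tauMat (n : ℕ) (K : Type*) [Field K] {X : Matrix (Fin n) (Fin n) K}
    (hX : IsUnit X.det) : (tauMat n K X)⁻¹ = antidiagJ n K * Xᵀ * antidiagJ n K := by
  rw [tauMat, Matrix.mul_inv_rev, Matrix.mul_inv_rev, inv_eq_right_inv (antidiagJ_mul_self n K),
    nonsing_inv_nonsing_inv _ (by rwa [det_transpose]), Matrix.mul_assoc]

/-- Over an algebraically closed field of characteristic `2`, an upper unitriangular
`3 × 3` matrix `ā` with equal superdiagonal entries `a₁` can be twisted-conjugated to
the identity by an upper unitriangular matrix `b ∈ SL(3, K)`: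
`b · ā · τ(b)⁻¹ = 1`, i.e. `āτ` is conjugate to `τ`. -/
theorem abar_equal_superdiagonal_conjugate_to_tau
    (K : Type*) [Field K] [IsAlgClosed K] [CharP K 2] (a₁ a₂ : K) :
    ∃ b : Matrix.SpecialLinearGroup (Fin 3) K,
      (b : Matrix (Fin 3) (Fin 3) K).BlockTriangular id ∧
      (∀ i, (b : Matrix (Fin 3) (Fin 3) K) i i = 1) ∧
      (b : Matrix (Fin 3) (Fin 3) K) * !![1, a₁, a₂; 0, 1, a₁; 0, 0, 1] *
        (tauMat 3 K (b : Matrix (Fin 3) (Fin 3) K))⁻¹ = 1 := by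
  obtain ⟨x, hx⟩ := IsAlgClosed.exists_pow_nat_eq a₂ two_pos
  have hdet : (!![1, x, 0; 0, 1, a₁ + x; 0, 0, 1] : Matrix (Fin 3) (Fin 3) K).det = 1 := by
    simp [det_fin_three]
  have h2 : (2 : K) = 0 := CharTwo.two_eq_zero
  refine ⟨⟨_, hdet⟩, ?_, ?_, ?_⟩
  · intro i j hij
    fin_cases i <;> fin_cases j <;> simp_all
  · intro i
    fin_cases i <;> rfl
  · rw [inv_tauMat 3 K (by simp [hdet])]
    subst hx
    ext i j
    fin_cases i <;> fin_cases j <;>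
      simp [antidiagJ, Matrix.mul_apply, Fin.sum_univ_three, one_apply] <;> grind
end
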